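/- arXiv:1405.5190 — 2 statements merged into one kernel-verified Lean document; each statement's English description precedes it below -/
import Mathlib

section
/- Let n ≥ 2 and let f : ℝ_{>0}^n → ℝ_{>0} be a quasi-sum production function, f(x_1,…,x_n) = G(h_1(x_1)+…+h_n(x_n)), where G and the h_j are twice differentiable strictly monotone real functions with G' > 0. If f satisfies the proportional marginal rate of substitution property (i.e. (∂f/∂x_j)/(∂f/∂x_i) = x_i/x_j for all i ≠ j and all x), then there exist a nonzero real number k and real constants C_1,…,C_n such that h_i(t) = k·ln t + C_i for every i = 1,…,n and all t > 0. -/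
/-- Partial derivative of `f : ℝⁿ → ℝ` with respect to the `i`-th coordinate at `x`. -/
noncomputable def pd {n : ℕ} (f : (Fin n → ℝ) → ℝ) (i : Fin n) (x : Fin n → ℝ) : ℝ :=
  deriv (fun t => f (Function.update x i t)) (x i)

/-- Chain rule for the partial derivatives of a quasi-sum on the positive orthant. -/
lemma pd_quasiSum {n : ℕ} {G : ℝ → ℝ} {h : Fin n → ℝ → ℝ} {f : (Fin n → ℝ) → ℝ}
    (hf : ∀ x : Fin n → ℝ, (∀ j, 0 < x j) → f x = G (∑ j, h j (x j)))
    (hG : Differentiable ℝ G) {x : Fin n → ℝ} (hx : ∀ j, 0 < x j) (i : Fin n)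
    (hh : DifferentiableAt ℝ (h i) (x i)) :
    pd f i x = deriv G (∑ j, h j (x j)) * deriv (h i) (x i) := by
  have hsum : HasDerivAt (fun t => ∑ j, h j (Function.update x i t j)) (deriv (h i) (x i))
      (x i) := by
    have key : HasDerivAt (fun t => ∑ j, h j (Function.update x i t j))
        (∑ j, if j = i then deriv (h i) (x i) else 0) (x i) := by
      refine HasDerivAt.fun_sum fun j _ => ?_
      by_cases hj : j = i
      · subst hj
        simpa using hh.hasDerivAt
      · simpa [hj] using hasDerivAt_const (x i) (h j (x j))
    simpa using key
  have hcomp : HasDerivAt (fun t => G (∑ j, h j (Function.update x i t j)))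
      (deriv G (∑ j, h j (x j)) * deriv (h i) (x i)) (x i) := by
    refine HasDerivAt.comp (x i) ?_ hsum
    simpa using (hG (∑ j, h j (x j))).hasDerivAt
  refine (hcomp.congr_of_eventuallyEq ?_).deriv
  filter_upwards [lt_mem_nhds (hx i)] with t ht
  refine hf _ fun j => ?_
  by_cases hj : j = i
  · subst hj
    simpa using ht
  · simpa [hj] using hx j

/-- A function on the positive half-line with derivative `k / t` is `k * log` up to a constant. -/
lemma eq_mul_log_add_of_mul_deriv_eq {g : ℝ → ℝ} {k : ℝ}
    (hg : ∀ t, 0 < t → DifferentiableAt ℝ g t) (hk : ∀ t, 0 < t → t * deriv g t = k)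
    {t : ℝ} (ht : 0 < t) : g t = k * Real.log t + g 1 := by
  have hder : ∀ s, 0 < s → HasDerivAt (fun u => g u - k * Real.log u) 0 s := by
    intro s hs
    have hsub := (hg s hs).hasDerivAt.fun_sub ((Real.hasDerivAt_log hs.ne').const_mul k)
    have hzero : deriv g s - k * s⁻¹ = 0 := by
      rw [← hk s hs]
      field_simp
      ring
    rwa [hzero] at hsub
  have hconst := isOpen_Ioi.is_const_of_deriv_eq_zero isPreconnected_Ioi
    (fun s hs => (hder s hs).differentiableAt.differentiableWithinAt)
    (fun s hs => (hder s hs).deriv) ht (Set.mem_Ioi.2 one_pos)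
  simp only [Real.log_one, mul_zero, sub_zero] at hconst
  linarith

/-- If a quasi-sum production function satisfies the proportional marginal rate of
substitution property, then `hᵢ(t) = k·ln t + Cᵢ` for a nonzero constant `k` and
real constants `Cᵢ`. -/
theorem quasiSum_proportionalMRS_inner_log
    (n : ℕ) (hn : 2 ≤ n)
    (G : ℝ → ℝ) (h : Fin n → ℝ → ℝ) (f : (Fin n → ℝ) → ℝ)
    (hf : ∀ x : Fin n → ℝ, (∀ j, 0 < x j) → f x = G (∑ j, h j (x j)))
    (hfpos : ∀ x : Fin n → ℝ, (∀ j, 0 < x j) → 0 < f x)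
    (hGdiff : Differentiable ℝ G)
    (hGdiff2 : Differentiable ℝ (deriv G))
    (hGmono : StrictMono G)
    (hG' : ∀ u : ℝ, 0 < deriv G u)
    (hhdiff : ∀ j, ∀ t : ℝ, 0 < t → DifferentiableAt ℝ (h j) t)
    (hhdiff2 : ∀ j, ∀ t : ℝ, 0 < t → DifferentiableAt ℝ (deriv (h j)) t)
    (hhmono : ∀ j, StrictMonoOn (h j) (Set.Ioi 0) ∨ StrictAntiOn (h j) (Set.Ioi 0))
    (hMRS : ∀ x : Fin n → ℝ, (∀ j, 0 < x j) → ∀ i j : Fin n, i ≠ j →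
        pd f j x / pd f i x = x i / x j) :
    ∃ k : ℝ, k ≠ 0 ∧ ∃ C : Fin n → ℝ, ∀ i : Fin n, ∀ t : ℝ, 0 < t →
      h i t = k * Real.log t + C i := by
  have hmul : ∀ i j : Fin n, i ≠ j → ∀ s t : ℝ, 0 < s → 0 < t →
      deriv (h i) s ≠ 0 ∧ t * deriv (h j) t = s * deriv (h i) s := by
    intro i j hij s t hs ht
    have hx : ∀ l, 0 < Function.update (fun _ => t) i s l := by
      intro l
      by_cases hl : l = i
      · subst hl
        simpa using hs
      · simpa [hl] using ht
    have hratio := hMRS _ hx i j hij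
    rw [pd_quasiSum hf hGdiff hx j (hhdiff j _ (hx j)),
      pd_quasiSum hf hGdiff hx i (hhdiff i _ (hx i)),
      mul_div_mul_left _ _ (hG' _).ne'] at hratio
    simp only [Function.update_self, Function.update_of_ne hij.symm] at hratio
    have hne : deriv (h i) s ≠ 0 := by
      intro h0
      rw [h0, div_zero] at hratio
      exact (div_pos hs ht).ne hratio
    refine ⟨hne, ?_⟩
    rw [div_eq_div_iff hne ht.ne'] at hratio
    linarith
  let a : Fin n := ⟨0, by omega⟩
  let b : Fin n := ⟨1, by omega⟩
  have hab : a ≠ b := by simp [a, b]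
  refine ⟨deriv (h a) 1, (hmul a b hab 1 1 one_pos one_pos).1, fun i => h i 1, fun i t ht =>
    eq_mul_log_add_of_mul_deriv_eq (hhdiff i) (fun s hs => ?_) ht⟩
  by_cases hi : i = a
  · subst hi
    linarith [(hmul a b hab s 1 hs one_pos).2, (hmul a b hab 1 1 one_pos one_pos).2]
  · linarith [(hmul a i (Ne.symm hi) 1 s one_pos hs).2]
end

section
/- Let n ≥ 2 and let f : ℝ_{>0}^n → ℝ_{>0} be a quasi-sum production function, f(x_1,…,x_n) = G(h_1(x_1)+…+h_n(x_n)), where G and the h_j are twice differentiable strictly monotone real functions with G' > 0, and suppose f satisfies the proportional marginal rate of substitution property. Then the determinant of the Hessian matrix (∂²f/∂x_i∂x_j) of f vanishes identically on ℝ_{>0}^n (equivalently, by the graph formula K = det(∂²f/∂x_i∂x_j)/w^{n+2}, the production hypersurface {(x, f(x))} ⊂ ℝ^{n+1} has vanishing Gauss–Kronecker curvature) if and only if there exist constants A > 0 and D ∈ ℝ such that f(x_1,…,x_n) = A·∏_{i=1}^n x_i^{1/n} + D, i.e. up to a translation f is a generalized Cobb–Douglas production function with constant return to scale. -/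
/-- Second partial derivative `∂²f/∂xⱼ∂xᵢ` at `x`. -/
noncomputable def pd2 {n : ℕ} (f : (Fin n → ℝ) → ℝ) (i j : Fin n) (x : Fin n → ℝ) : ℝ :=
  pd (pd f i) j x

lemma update_pos {n : ℕ} {x : Fin n → ℝ} (hx : ∀ j, 0 < x j) (i : Fin n) {t : ℝ}
    (ht : 0 < t) (j : Fin n) : 0 < Function.update x i t j := by
  rcases eq_or_ne j i with rfl | hji
  · simpa using ht
  · simpa [hji] using hx j

/-- The partial derivatives on the positive orthant depend only on the values there. -/
lemma pd_congr_of_eqOn_pos {n : ℕ} {f g : (Fin n → ℝ) → ℝ}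
    (hfg : ∀ x : Fin n → ℝ, (∀ j, 0 < x j) → f x = g x) {x : Fin n → ℝ} (hx : ∀ j, 0 < x j)
    (i : Fin n) : pd f i x = pd g i x := by
  refine Filter.EventuallyEq.deriv_eq ?_
  filter_upwards [lt_mem_nhds (hx i)] with t ht
  exact hfg _ (update_pos hx i ht)

lemma hasDerivAt_sum_update {n : ℕ} (h : Fin n → ℝ → ℝ) (x : Fin n → ℝ) (i : Fin n) {d : ℝ}
    (hd : HasDerivAt (h i) d (x i)) :
    HasDerivAt (fun t => ∑ j, h j (Function.update x i t j)) d (x i) := by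
  have hsum : HasDerivAt (fun t => ∑ j, h j (Function.update x i t j))
      (∑ j, if j = i then d else 0) (x i) := by
    refine HasDerivAt.fun_sum fun j _ => ?_
    rcases eq_or_ne j i with rfl | hji
    · simpa using hd
    · simpa [hji] using hasDerivAt_const (x i) (h j (x j))
  simpa using hsum

lemma pd_comp_sum {n : ℕ} {G : ℝ → ℝ} (hG : Differentiable ℝ G) (h : Fin n → ℝ → ℝ)
    (x : Fin n → ℝ) (i : Fin n) (hd : DifferentiableAt ℝ (h i) (x i)) :
    pd (fun y => G (∑ j, h j (y j))) i x = deriv G (∑ j, h j (x j)) * deriv (h i) (x i) := by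
  have hs := hasDerivAt_sum_update h x i hd.hasDerivAt
  have hcomp := HasDerivAt.comp_of_eq (x i) (hG (∑ j, h j (x j))).hasDerivAt hs (by simp)
  exact hcomp.deriv

lemma pd_comp_sum_log {n : ℕ} {f : (Fin n → ℝ) → ℝ} {F : ℝ → ℝ} (hF : Differentiable ℝ F)
    (hf : ∀ x : Fin n → ℝ, (∀ j, 0 < x j) → f x = F (∑ j, Real.log (x j)))
    {x : Fin n → ℝ} (hx : ∀ j, 0 < x j) (i : Fin n) :
    pd f i x = deriv F (∑ j, Real.log (x j)) / x i := by
  rw [pd_congr_of_eqOn_pos hf hx,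
    pd_comp_sum hF (fun _ => Real.log) x i (Real.differentiableAt_log (hx i).ne'),
    Real.deriv_log, div_eq_mul_inv]

lemma pd2_comp_sum_log {n : ℕ} {f : (Fin n → ℝ) → ℝ} {F : ℝ → ℝ} (hF : Differentiable ℝ F)
    (hF2 : Differentiable ℝ (deriv F))
    (hf : ∀ x : Fin n → ℝ, (∀ j, 0 < x j) → f x = F (∑ j, Real.log (x j)))
    {x : Fin n → ℝ} (hx : ∀ j, 0 < x j) (i j : Fin n) :
    pd2 f i j x = deriv (deriv F) (∑ k, Real.log (x k)) / (x i * x j)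
      - if i = j then deriv F (∑ k, Real.log (x k)) / x i ^ 2 else 0 := by
  have hxi := (hx i).ne'
  have hxj := (hx j).ne'
  have hnum := HasDerivAt.comp_of_eq (x j) (hF2 (∑ k, Real.log (x k))).hasDerivAt
    (hasDerivAt_sum_update (fun _ => Real.log) x j (Real.hasDerivAt_log hxj)) (by simp)
  rw [pd2, pd_congr_of_eqOn_pos (fun y hy => pd_comp_sum_log hF hf hy i) hx]
  have hden : HasDerivAt (fun t => Function.update x j t i) (if i = j then 1 else 0) (x j) := by
    rcases eq_or_ne i j with rfl | hij
    · simpa using hasDerivAt_id' (x i)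
    · simpa [hij] using hasDerivAt_const (x j) (x i)
  have hdiv := hnum.fun_div hden (by simpa using hxi)
  refine hdiv.deriv.trans ?_
  rcases eq_or_ne i j with rfl | hij
  · simp
    field_simp
  · simp [hij]
    field_simp

/-- For `f = F (∑ log xᵢ)` with `F' ≠ 0`, the Hessian is degenerate exactly where `F' = n F''`. -/
lemma det_hessian_comp_sum_log_eq_zero_iff {n : ℕ} {f : (Fin n → ℝ) → ℝ} {F : ℝ → ℝ}
    (hF : Differentiable ℝ F) (hF2 : Differentiable ℝ (deriv F)) (hF' : ∀ s, deriv F s ≠ 0)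
    (hf : ∀ x : Fin n → ℝ, (∀ j, 0 < x j) → f x = F (∑ j, Real.log (x j)))
    {x : Fin n → ℝ} (hx : ∀ j, 0 < x j) :
    Matrix.det (Matrix.of fun i j => pd2 f i j x) = 0 ↔
      deriv F (∑ j, Real.log (x j)) = n * deriv (deriv F) (∑ j, Real.log (x j)) := by
  set s := ∑ j, Real.log (x j) with hs
  have hne := hF' s
  have hfactor : (Matrix.of fun i j => pd2 f i j x) =
      Matrix.diagonal (fun i => -deriv F s / x i ^ 2) *
        (1 + Matrix.replicateCol Unit (fun i => -deriv (deriv F) s / deriv F s * x i) *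
          Matrix.replicateRow Unit (fun j => 1 / x j)) := by
    ext i j
    have hxi := (hx i).ne'
    have hxj := (hx j).ne'
    rw [Matrix.of_apply, pd2_comp_sum_log hF hF2 hf hx, ← hs, Matrix.diagonal_mul,
      Matrix.add_apply, Matrix.mul_apply]
    rcases eq_or_ne i j with rfl | hij
    · simp
      field_simp
      ring
    · simp [hij]
      field_simp
  have hdot : (fun j => 1 / x j) ⬝ᵥ (fun i => -deriv (deriv F) s / deriv F s * x i) =
      n * (-deriv (deriv F) s / deriv F s) := by
    have hterm : ∀ i, 1 / x i * (-deriv (deriv F) s / deriv F s * x i) =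
        -deriv (deriv F) s / deriv F s := fun i => by
      have hxi := (hx i).ne'
      field_simp
    simp [dotProduct, hterm, -one_div]
  have hprod : ∏ i, -deriv F s / x i ^ 2 ≠ 0 :=
    Finset.prod_ne_zero_iff.2 fun i _ => div_ne_zero (neg_ne_zero.2 hne) (pow_ne_zero 2 (hx i).ne')
  rw [hfactor, Matrix.det_mul, Matrix.det_diagonal,
    Matrix.det_one_add_replicateCol_mul_replicateRow, hdot, mul_eq_zero, or_iff_right hprod]
  field_simp
  constructor <;> intro h <;> linarith

/-- A function on the half-line whose elasticity numerator `t h'(t)` is constant is logarithmic. -/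
lemma exists_eq_mul_log_add {g : ℝ → ℝ} {c : ℝ} (hg : ∀ t : ℝ, 0 < t → DifferentiableAt ℝ g t)
    (hc : ∀ t : ℝ, 0 < t → t * deriv g t = c) :
    ∃ d : ℝ, ∀ t : ℝ, 0 < t → g t = c * Real.log t + d := by
  have hderiv : ∀ t ∈ Set.Ioi (0 : ℝ), HasDerivAt (fun t => g t - c * Real.log t) 0 t := by
    intro t ht
    have ht0 : t ≠ 0 := ne_of_gt ht
    refine ((hg t ht).hasDerivAt.fun_sub ((Real.hasDerivAt_log ht0).const_mul c)).congr_deriv ?_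
    rw [← hc t ht]
    field_simp
    ring
  refine ⟨g 1, fun t ht => ?_⟩
  obtain ⟨a, ha⟩ := isOpen_Ioi.exists_is_const_of_deriv_eq_zero isPreconnected_Ioi
    (fun t ht => (hderiv t ht).differentiableAt.differentiableWithinAt)
    (fun t ht => (hderiv t ht).deriv)
  have heq := (ha t ht).trans (ha 1 (Set.mem_Ioi.2 one_pos)).symm
  simp only [Real.log_one, mul_zero, sub_zero] at heq
  linarith

/-- A quasi-sum with the proportional marginal rate of substitution property is a function of the
sum of the logarithms. -/
lemma exists_eq_comp_sum_log_of_proportionalMRS {n : ℕ} (hn : 2 ≤ n)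
    {G : ℝ → ℝ} {h : Fin n → ℝ → ℝ} {f : (Fin n → ℝ) → ℝ}
    (hf : ∀ x : Fin n → ℝ, (∀ j, 0 < x j) → f x = G (∑ j, h j (x j)))
    (hG : Differentiable ℝ G)
    (hh : ∀ j, ∀ t : ℝ, 0 < t → DifferentiableAt ℝ (h j) t)
    (hMRS : ∀ x : Fin n → ℝ, (∀ j, 0 < x j) → ∀ i j : Fin n, i ≠ j →
        pd f j x / pd f i x = x i / x j) :
    ∃ c d : ℝ, c ≠ 0 ∧
      ∀ x : Fin n → ℝ, (∀ j, 0 < x j) → f x = G (c * ∑ j, Real.log (x j) + d) := by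
  have hpd : ∀ x : Fin n → ℝ, (∀ j, 0 < x j) → ∀ i,
      pd f i x = deriv G (∑ j, h j (x j)) * deriv (h i) (x i) := fun x hx i => by
    rw [pd_congr_of_eqOn_pos hf hx, pd_comp_sum hG h x i (hh i _ (hx i))]
  have hmrs : ∀ i j : Fin n, i ≠ j → ∀ s t : ℝ, 0 < s → 0 < t →
      deriv (h i) s ≠ 0 ∧ s * deriv (h i) s = t * deriv (h j) t := by
    intro i j hij s t hs ht
    have hx : ∀ k, 0 < Function.update (fun _ => t) i s k := update_pos (fun _ => ht) i hs
    have hxi : Function.update (fun _ => t) i s i = s := by simp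
    have hxj : Function.update (fun _ => t) i s j = t := by simp [hij.symm]
    have hquot := hMRS _ hx i j hij
    rw [hpd _ hx, hpd _ hx, hxi, hxj] at hquot
    have hpos := div_pos hs ht
    have hden : deriv G (∑ k, h k (Function.update (fun _ => t) i s k)) * deriv (h i) s ≠ 0 := by
      intro h0
      rw [h0, div_zero] at hquot
      exact hpos.ne hquot
    have hi := right_ne_zero_of_mul hden
    have hG0 := left_ne_zero_of_mul hden
    refine ⟨hi, ?_⟩
    rw [mul_div_mul_left _ _ hG0, div_eq_div_iff hi ht.ne'] at hquot
    linarith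
  let i₀ : Fin n := ⟨0, by omega⟩
  let i₁ : Fin n := ⟨1, by omega⟩
  have hne : i₀ ≠ i₁ := by simp [i₀, i₁]
  have hconst : ∀ j, ∀ t : ℝ, 0 < t → t * deriv (h j) t = deriv (h i₀) 1 := by
    intro j t ht
    have h01 := (hmrs i₀ i₁ hne 1 1 one_pos one_pos).2
    rcases eq_or_ne j i₀ with rfl | hj
    · have := (hmrs i₀ i₁ hne t 1 ht one_pos).2
      linarith
    · have := (hmrs j i₀ hj t 1 ht one_pos).2
      linarith
  choose d hd using fun j => exists_eq_mul_log_add (hh j) (hconst j)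
  refine ⟨deriv (h i₀) 1, ∑ j, d j, (hmrs i₀ i₁ hne 1 1 one_pos one_pos).1, fun x hx => ?_⟩
  rw [hf x hx, Finset.mul_sum, ← Finset.sum_add_distrib]
  exact congrArg G (Finset.sum_congr rfl fun j _ => hd j _ (hx j))

/-- Solutions of the linear equation `F' = a F''` with `a ≠ 0`. -/
lemma exists_eq_mul_exp_add {F : ℝ → ℝ} {a : ℝ} (ha : a ≠ 0) (hF : Differentiable ℝ F)
    (hF2 : Differentiable ℝ (deriv F)) (hode : ∀ s, deriv F s = a * deriv (deriv F) s) :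
    ∃ D : ℝ, ∀ s, F s = a * deriv F 0 * Real.exp (s / a) + D := by
  have hexp : ∀ s, HasDerivAt (fun s => Real.exp (-(s / a)))
      (Real.exp (-(s / a)) * -(1 / a)) s := fun s =>
    ((hasDerivAt_id s).div_const a).neg.exp
  have hlin : ∀ s, F s - a * deriv F s = F 0 - a * deriv F 0 := by
    intro s
    have hd : ∀ s, HasDerivAt (fun s => F s - a * deriv F s) 0 s := fun s => by
      refine ((hF s).hasDerivAt.fun_sub ((hF2 s).hasDerivAt.const_mul a)).congr_deriv ?_
      rw [← hode, sub_self]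
    exact is_const_of_deriv_eq_zero (fun s => (hd s).differentiableAt) (fun s => (hd s).deriv) s 0
  have hderiv : ∀ s, deriv F s * Real.exp (-(s / a)) = deriv F 0 := by
    intro s
    have hd : ∀ s, HasDerivAt (fun s => deriv F s * Real.exp (-(s / a))) 0 s := fun s => by
      refine ((hF2 s).hasDerivAt.fun_mul (hexp s)).congr_deriv ?_
      rw [hode s]
      field_simp
      ring
    simpa using
      is_const_of_deriv_eq_zero (fun s => (hd s).differentiableAt) (fun s => (hd s).deriv) s 0
  refine ⟨F 0 - a * deriv F 0, fun s => ?_⟩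
  have hexp1 : Real.exp (-(s / a)) * Real.exp (s / a) = 1 := by
    rw [← Real.exp_add]; simp
  rw [← hlin s, ← hderiv s]
  linear_combination (-a * deriv F s) * hexp1

lemma exp_sum_log_div {n : ℕ} {x : Fin n → ℝ} (hx : ∀ j, 0 < x j) :
    Real.exp ((∑ j, Real.log (x j)) / n) = ∏ i, x i ^ ((1 : ℝ) / n) := by
  rw [Finset.sum_div, Real.exp_sum]
  refine Finset.prod_congr rfl fun i _ => ?_
  rw [Real.rpow_def_of_pos (hx i), mul_one_div]

/-- A quasi-sum production function satisfying the proportional marginal rate of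
substitution property has identically vanishing Hessian determinant (equivalently, its
production hypersurface has vanishing Gauss–Kronecker curvature) iff, up to a translation,
it is the generalized Cobb–Douglas function with constant return to scale
`f(x) = A·∏ᵢ xᵢ^{1/n} + D`. -/
theorem quasiSum_proportionalMRS_vanishing_GaussKronecker_iff
    (n : ℕ) (hn : 2 ≤ n)
    (G : ℝ → ℝ) (h : Fin n → ℝ → ℝ) (f : (Fin n → ℝ) → ℝ)
    (hf : ∀ x : Fin n → ℝ, (∀ j, 0 < x j) → f x = G (∑ j, h j (x j)))
    (hfpos : ∀ x : Fin n → ℝ, (∀ j, 0 < x j) → 0 < f x)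
    (hGdiff : Differentiable ℝ G)
    (hGdiff2 : Differentiable ℝ (deriv G))
    (hGmono : StrictMono G)
    (hG' : ∀ u : ℝ, 0 < deriv G u)
    (hhdiff : ∀ j, ∀ t : ℝ, 0 < t → DifferentiableAt ℝ (h j) t)
    (hhdiff2 : ∀ j, ∀ t : ℝ, 0 < t → DifferentiableAt ℝ (deriv (h j)) t)
    (hhmono : ∀ j, StrictMonoOn (h j) (Set.Ioi 0) ∨ StrictAntiOn (h j) (Set.Ioi 0))
    (hMRS : ∀ x : Fin n → ℝ, (∀ j, 0 < x j) → ∀ i j : Fin n, i ≠ j →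
        pd f j x / pd f i x = x i / x j) :
    (∀ x : Fin n → ℝ, (∀ j, 0 < x j) →
        Matrix.det (Matrix.of fun i j => pd2 f i j x) = 0)
      ↔ ∃ A D : ℝ, 0 < A ∧ ∀ x : Fin n → ℝ, (∀ j, 0 < x j) →
          f x = A * (∏ i, (x i) ^ ((1 : ℝ) / n)) + D := by
  have hn0 : (n : ℝ) ≠ 0 := Nat.cast_ne_zero.2 (by omega)
  obtain ⟨c, d, hc, hfG⟩ := exists_eq_comp_sum_log_of_proportionalMRS hn hf hGdiff hhdiff hMRS
  let F : ℝ → ℝ := fun s => G (c * s + d)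
  have hlin : ∀ s, HasDerivAt (fun s => c * s + d) c s := fun s => by
    simpa using ((hasDerivAt_id s).const_mul c).add_const d
  have hFd : ∀ s, HasDerivAt F (deriv G (c * s + d) * c) s := fun s =>
    (hGdiff _).hasDerivAt.comp s (hlin s)
  have hFderiv : deriv F = fun s => deriv G (c * s + d) * c := funext fun s => (hFd s).deriv
  have hF : Differentiable ℝ F := fun s => (hFd s).differentiableAt
  have hF2 : Differentiable ℝ (deriv F) := by
    rw [hFderiv]
    exact (hGdiff2.comp fun s => (hlin s).differentiableAt).mul_const c
  have hF' : ∀ s, deriv F s ≠ 0 := fun s => by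
    rw [hFderiv]
    exact mul_ne_zero (hG' _).ne' hc
  have hfF : ∀ x : Fin n → ℝ, (∀ j, 0 < x j) → f x = F (∑ j, Real.log (x j)) := hfG
  have hsurj : ∀ s : ℝ, ∃ x : Fin n → ℝ, (∀ j, 0 < x j) ∧ ∑ j, Real.log (x j) = s := fun s =>
    ⟨fun _ => Real.exp (s / n), fun _ => Real.exp_pos _, by simp; field_simp⟩
  constructor
  · intro hdet
    have hode : ∀ s, deriv F s = n * deriv (deriv F) s := fun s => by
      obtain ⟨x, hx, rfl⟩ := hsurj s
      exact (det_hessian_comp_sum_log_eq_zero_iff hF hF2 hF' hfF hx).1 (hdet x hx)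
    obtain ⟨D, hD⟩ := exists_eq_mul_exp_add hn0 hF hF2 hode
    refine ⟨n * deriv F 0, D, ?_, fun x hx => by rw [hfF x hx, hD, exp_sum_log_div hx]⟩
    by_contra hA
    have hA : n * deriv F 0 < 0 := lt_of_le_of_ne (not_lt.1 hA) (mul_ne_zero hn0 (hF' 0))
    set A := n * deriv F 0
    obtain ⟨x, hx, hs⟩ := hsurj (n * (|D| / -A))
    have hpos := hfpos x hx
    rw [hfF x hx, hs, hD, mul_div_cancel_left₀ _ hn0] at hpos
    have hexp := mul_le_mul_of_nonpos_left (Real.add_one_le_exp (|D| / -A)) hA.le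
    have hcancel : A * (|D| / -A + 1) = -|D| + A := by
      have := hA.ne
      field_simp
    linarith [le_abs_self D]
  · rintro ⟨A, D, -, hAD⟩ x hx
    have hFexp : F = fun s => A * Real.exp (s / n) + D := funext fun s => by
      obtain ⟨y, hy, rfl⟩ := hsurj s
      rw [← hfF y hy, hAD y hy, exp_sum_log_div hy]
    have hexp : ∀ s : ℝ, HasDerivAt (fun s => Real.exp (s / n)) (Real.exp (s / n) * (1 / n)) s :=
      fun s => ((hasDerivAt_id s).div_const (n : ℝ)).exp
    have hd1 : deriv F = fun s => A * (Real.exp (s / n) * (1 / n)) := by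
      rw [hFexp]
      exact funext fun s => (((hexp s).const_mul A).add_const D).deriv
    have hd2 : ∀ s, deriv (deriv F) s = A * (Real.exp (s / n) * (1 / n) * (1 / n)) := fun s => by
      rw [hd1]
      exact (((hexp s).mul_const (1 / (n : ℝ))).const_mul A).deriv
    rw [det_hessian_comp_sum_log_eq_zero_iff hF hF2 hF' hfF hx, hd2, hd1]
    field_simp
end
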